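/- Let V be a real vector space of dimension k ≥ 2, I, J ⊆ ℝ open intervals, and ε : I → V a smooth curve such that for every t ∈ I the vectors ε(t), …, ε⁽ᵏ⁻¹⁾(t) form a basis of V and ε⁽ᵏ⁾(t) ∈ span{ε⁽ⁱ⁾(t) : 0 ≤ i ≤ k−3} for all t (i.e., the coefficients of both ε⁽ᵏ⁻¹⁾ and ε⁽ᵏ⁻²⁾ vanish). Let φ : J → I be a smooth map with φ'(τ) ≠ 0 for all τ, and g : J → ℝ a smooth nowhere-vanishing function such that ε̃(τ) = g(τ)·ε(φ(τ)) also satisfies ε̃⁽ᵏ⁾(τ) ∈ span{ε̃⁽ⁱ⁾(τ) : 0 ≤ i ≤ k−3} for all τ ∈ J. Then the Schwarzian derivative S(φ) = (φ''/(2φ'))' − (φ''/(2φ'))² vanishes identically on J. -/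

import Mathlib

/-- The coefficients of the vectors `ε⁽ʲ⁾ ∘ φ` in the `n`-th derivative of `g • (ε ∘ φ)`,
where `f` is the derivative of `φ`. -/
noncomputable def reparamCoeff (f g : ℝ → ℝ) : ℕ → ℕ → ℝ → ℝ
  | 0, 0 => g
  | 0, _ + 1 => 0
  | n + 1, 0 => deriv (reparamCoeff f g n 0)
  | n + 1, j + 1 => fun τ => deriv (reparamCoeff f g n (j + 1)) τ + f τ * reparamCoeff f g n j τ

theorem ContDiffOn.deriv_of_isOpen_top {J : Set ℝ} (hJ : IsOpen J) {f : ℝ → ℝ}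
    (hf : ContDiffOn ℝ (⊤ : ℕ∞) f J) : ContDiffOn ℝ (⊤ : ℕ∞) (deriv f) J :=
  ContDiffOn.deriv_of_isOpen hf hJ (by exact_mod_cast le_refl _)

theorem ContDiffOn.hasDerivAt_of_isOpen_top {E : Type*} [NormedAddCommGroup E] [NormedSpace ℝ E]
    {J : Set ℝ} (hJ : IsOpen J) {f : ℝ → E}
    (hf : ContDiffOn ℝ (⊤ : ℕ∞) f J) {τ : ℝ} (hτ : τ ∈ J) : HasDerivAt f (deriv f τ) τ :=
  ((hf.differentiableOn (by simp)).differentiableAt (hJ.mem_nhds hτ)).hasDerivAt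

theorem deriv_eq_of_eqOn_isOpen {E : Type*} [NormedAddCommGroup E] [NormedSpace ℝ E]
    {J : Set ℝ} (hJ : IsOpen J) {a b : ℝ → E} (hab : Set.EqOn a b J) {τ : ℝ} (hτ : τ ∈ J) :
    deriv a τ = deriv b τ :=
  (hab.eventuallyEq_of_mem (hJ.mem_nhds hτ)).deriv_eq

theorem hasDerivAt_iteratedDerivWithin_of_isOpen {E : Type*} [NormedAddCommGroup E]
    [NormedSpace ℝ E] {I : Set ℝ} (hI : IsOpen I) {ε : ℝ → E}
    (hε : ContDiffOn ℝ (⊤ : ℕ∞) ε I) (n : ℕ) {t : ℝ} (ht : t ∈ I) :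
    HasDerivAt (iteratedDerivWithin n ε I) (iteratedDerivWithin (n + 1) ε I t) t := by
  have hd : DifferentiableOn ℝ (iteratedDerivWithin n ε I) I :=
    hε.differentiableOn_iteratedDerivWithin (by exact_mod_cast WithTop.coe_lt_top n)
      hI.uniqueDiffOn
  rw [iteratedDerivWithin_succ, derivWithin_of_isOpen hI ht]
  exact (hd.differentiableAt (hI.mem_nhds ht)).hasDerivAt

section Coefficients

variable {J : Set ℝ} {f g : ℝ → ℝ}

theorem contDiffOn_reparamCoeff (hJ : IsOpen J) (hf : ContDiffOn ℝ (⊤ : ℕ∞) f J)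
    (hg : ContDiffOn ℝ (⊤ : ℕ∞) g J) (n j : ℕ) :
    ContDiffOn ℝ (⊤ : ℕ∞) (reparamCoeff f g n j) J := by
  induction n generalizing j with
  | zero =>
    cases j with
    | zero => exact hg
    | succ j => exact contDiffOn_const
  | succ n ih =>
    cases j with
    | zero => exact (ih 0).deriv_of_isOpen_top hJ
    | succ j => exact ((ih (j + 1)).deriv_of_isOpen_top hJ).add (hf.mul (ih j))

theorem reparamCoeff_eq_zero (f g : ℝ → ℝ) {n j : ℕ} (h : n < j) : reparamCoeff f g n j = 0 := by
  induction n generalizing j with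
  | zero =>
    cases j with
    | zero => omega
    | succ j => rfl
  | succ n ih =>
    cases j with
    | zero => omega
    | succ j =>
      funext τ
      simp [reparamCoeff, ih (show n < j by omega), ih (show n < j + 1 by omega)]

theorem reparamCoeff_self (f g : ℝ → ℝ) (n : ℕ) (τ : ℝ) :
    reparamCoeff f g n n τ = g τ * f τ ^ n := by
  induction n with
  | zero => simp [reparamCoeff]
  | succ n ih =>
    simp only [reparamCoeff, reparamCoeff_eq_zero f g (Nat.lt_succ_self n), ih]
    simp only [deriv_zero, Pi.zero_apply]
    ring

theorem hasDerivAt_mul_pow (hJ : IsOpen J) (hf : ContDiffOn ℝ (⊤ : ℕ∞) f J)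
    (hg : ContDiffOn ℝ (⊤ : ℕ∞) g J) (hf0 : ∀ τ ∈ J, f τ ≠ 0) (hg0 : ∀ τ ∈ J, g τ ≠ 0)
    (n : ℕ) {τ : ℝ} (hτ : τ ∈ J) :
    HasDerivAt (fun σ => g σ * f σ ^ n)
      (g τ * f τ ^ n * (deriv g τ / g τ + n * (deriv f τ / f τ))) τ := by
  refine ((hg.hasDerivAt_of_isOpen_top hJ hτ).mul
    ((hf.hasDerivAt_of_isOpen_top hJ hτ).pow n)).congr_deriv ?_
  have h1 := hf0 τ hτ
  have h2 := hg0 τ hτ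
  cases n with
  | zero => simp; field_simp
  | succ n => simp only [Nat.add_sub_cancel, Pi.pow_apply]; push_cast; field_simp; ring

theorem reparamCoeff_succ_self (hJ : IsOpen J) (hf : ContDiffOn ℝ (⊤ : ℕ∞) f J)
    (hg : ContDiffOn ℝ (⊤ : ℕ∞) g J) (hf0 : ∀ τ ∈ J, f τ ≠ 0) (hg0 : ∀ τ ∈ J, g τ ≠ 0)
    (n : ℕ) {τ : ℝ} (hτ : τ ∈ J) :
    reparamCoeff f g (n + 1) n τ = g τ * f τ ^ n *
      ((n + 1) * (deriv g τ / g τ) + (n + 1) * n / 2 * (deriv f τ / f τ)) := by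
  induction n with
  | zero =>
    have h2 := hg0 τ hτ
    simp [reparamCoeff]
    field_simp
  | succ n ih =>
    have hd := (hasDerivAt_mul_pow hJ hf hg hf0 hg0 (n + 1) hτ).deriv
    rw [← funext (reparamCoeff_self f g (n + 1))] at hd
    rw [reparamCoeff]
    beta_reduce
    rw [ih, hd]
    push_cast
    ring

theorem reparamCoeff_add_two_self (hJ : IsOpen J) (hf : ContDiffOn ℝ (⊤ : ℕ∞) f J)
    (hg : ContDiffOn ℝ (⊤ : ℕ∞) g J) (hf0 : ∀ τ ∈ J, f τ ≠ 0) (hg0 : ∀ τ ∈ J, g τ ≠ 0)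
    (n : ℕ) {h u : ℝ → ℝ} (hh : h = fun σ => deriv g σ / g σ) (hu : u = fun σ => deriv f σ / f σ)
    {τ : ℝ} (hτ : τ ∈ J) :
    reparamCoeff f g (n + 2) n τ = g τ * f τ ^ n *
      ((n + 2) * (n + 1) / 2 * (deriv h τ + h τ ^ 2)
        + (n + 2) * (n + 1) * n / 6 * (deriv u τ + 3 * h τ * u τ + u τ ^ 2)
        + (n + 2) * (n + 1) * n * (n - 1) / 8 * u τ ^ 2) := by
  have hhs : ContDiffOn ℝ (⊤ : ℕ∞) h J := by
    rw [hh]; exact (hg.deriv_of_isOpen_top hJ).div hg hg0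
  have hus : ContDiffOn ℝ (⊤ : ℕ∞) u J := by
    rw [hu]; exact (hf.deriv_of_isOpen_top hJ).div hf hf0
  have key (n : ℕ) : deriv (reparamCoeff f g (n + 1) n) τ = g τ * f τ ^ n *
      ((h τ + n * u τ) * ((n + 1) * h τ + (n + 1) * n / 2 * u τ)
        + ((n + 1) * deriv h τ + (n + 1) * n / 2 * deriv u τ)) := by
    have he : Set.EqOn (reparamCoeff f g (n + 1) n)
        (fun σ => g σ * f σ ^ n * ((n + 1) * h σ + (n + 1) * n / 2 * u σ)) J := fun σ hσ => by
      simpa only [hh, hu] using reparamCoeff_succ_self hJ hf hg hf0 hg0 n hσ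
    rw [deriv_eq_of_eqOn_isOpen hJ he hτ]
    refine ((hasDerivAt_mul_pow hJ hf hg hf0 hg0 n hτ).mul
      (((hhs.hasDerivAt_of_isOpen_top hJ hτ).const_mul ((n : ℝ) + 1)).add
      ((hus.hasDerivAt_of_isOpen_top hJ hτ).const_mul (((n : ℝ) + 1) * n / 2)))).deriv.trans ?_
    simp only [Pi.add_apply, hh, hu]
    ring
  induction n with
  | zero =>
    rw [reparamCoeff, key 0]
    push_cast
    ring
  | succ n ih =>
    rw [reparamCoeff]
    beta_reduce
    rw [ih, key (n + 1)]
    push_cast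
    ring

theorem iteratedDerivWithin_smul_comp {V : Type*} [NormedAddCommGroup V] [NormedSpace ℝ V]
    {I : Set ℝ} (hI : IsOpen I) (hJ : IsOpen J) {ε : ℝ → V} (hε : ContDiffOn ℝ (⊤ : ℕ∞) ε I)
    {φ : ℝ → ℝ} (hφ : ∀ τ ∈ J, HasDerivAt φ (f τ) τ) (hφJI : Set.MapsTo φ J I)
    (hf : ContDiffOn ℝ (⊤ : ℕ∞) f J) (hg : ContDiffOn ℝ (⊤ : ℕ∞) g J) (n : ℕ) :
    ∀ τ ∈ J, iteratedDerivWithin n (fun σ => g σ • ε (φ σ)) J τ =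
      ∑ j ∈ Finset.range (n + 1), reparamCoeff f g n j τ • iteratedDerivWithin j ε I (φ τ) := by
  induction n with
  | zero => intro τ _; simp [reparamCoeff]
  | succ n ih =>
    intro τ hτ
    rw [iteratedDerivWithin_succ, derivWithin_of_isOpen hJ hτ, deriv_eq_of_eqOn_isOpen hJ ih hτ]
    have hd : HasDerivAt (fun σ => ∑ j ∈ Finset.range (n + 1),
        reparamCoeff f g n j σ • iteratedDerivWithin j ε I (φ σ))
        (∑ j ∈ Finset.range (n + 1),
          (reparamCoeff f g n j τ • f τ • iteratedDerivWithin (j + 1) ε I (φ τ) +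
            deriv (reparamCoeff f g n j) τ • iteratedDerivWithin j ε I (φ τ))) τ :=
      HasDerivAt.fun_sum fun j _ =>
        ((contDiffOn_reparamCoeff hJ hf hg n j).hasDerivAt_of_isOpen_top hJ hτ).smul
          ((hasDerivAt_iteratedDerivWithin_of_isOpen hI hε j (hφJI hτ)).scomp τ (hφ τ hτ))
    rw [hd.deriv, Finset.sum_range_succ' _ (n + 1), Finset.sum_add_distrib]
    simp only [reparamCoeff, add_smul, Finset.sum_add_distrib]
    rw [Finset.sum_range_succ (fun j => deriv (reparamCoeff f g n (j + 1)) τ • _) n,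
      reparamCoeff_eq_zero f g (Nat.lt_succ_self n),
      Finset.sum_range_succ' (fun j => deriv (reparamCoeff f g n j) τ • _) n]
    simp only [smul_smul, mul_comm (f τ), deriv_zero, Pi.zero_apply, zero_smul, add_zero]
    abel

end Coefficients

theorem LinearIndependent.eq_zero_of_add_mem_span {V : Type*} [AddCommGroup V] [Module ℝ V]
    {m : ℕ} {v : ℕ → V} (hv : LinearIndependent ℝ (fun i : Fin (m + 2) => v i)) {x y : ℝ}
    (h : x • v m + y • v (m + 1) ∈ Submodule.span ℝ (Set.range fun i : Fin m => v i)) :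
    x = 0 ∧ y = 0 := by
  obtain ⟨c, hc⟩ := (Submodule.mem_span_range_iff_exists_fun ℝ).1 h
  let d : Fin (m + 2) → ℝ := Fin.snoc (Fin.snoc (fun i => -c i) x : Fin (m + 1) → ℝ) y
  have hd := Fintype.linearIndependent_iff.1 hv d (by
    simp only [Fin.sum_univ_castSucc, d, Fin.snoc_castSucc, Fin.snoc_last, Fin.val_castSucc,
      Fin.val_last, neg_smul, Finset.sum_neg_distrib, hc]
    abel)
  constructor
  · simpa [d] using hd (Fin.last m).castSucc
  · simpa [d] using hd (Fin.last (m + 1))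


/-- The canonical projective structure (Section 5): if `ε` is a canonical representative
of a regular curve in `ℙV` (`dim V = k`) with `B_{k−2} ≡ 0`, i.e.
`ε⁽ᵏ⁾(t) ∈ span{ε⁽ⁱ⁾(t) : 0 ≤ i ≤ k−3}`, and the reparameterized representative
`ε̃(τ) = g(τ)ε(φ(τ))` has the same property, then the Schwarzian derivative
`S(φ) = (φ''/(2φ'))' − (φ''/(2φ'))²` vanishes identically (so `φ` is a Möbius
transformation). -/
theorem projective_parameters_moebius
    {V : Type*} [NormedAddCommGroup V] [NormedSpace ℝ V] [FiniteDimensional ℝ V]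
    (k : ℕ) (hk : 2 ≤ k) (hdim : Module.finrank ℝ V = k)
    (I : Set ℝ) (hIopen : IsOpen I) (hIconn : I.OrdConnected)
    (J : Set ℝ) (hJopen : IsOpen J) (hJconn : J.OrdConnected)
    (ε : ℝ → V) (hε : ContDiffOn ℝ (⊤ : ℕ∞) ε I)
    (hreg : ∀ t ∈ I,
      LinearIndependent ℝ (fun i : Fin k => iteratedDerivWithin (i : ℕ) ε I t) ∧
      Submodule.span ℝ (Set.range fun i : Fin k => iteratedDerivWithin (i : ℕ) ε I t) = ⊤)
    (hproj : ∀ t ∈ I, iteratedDerivWithin k ε I t ∈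
      Submodule.span ℝ (Set.range fun i : Fin (k - 2) => iteratedDerivWithin (i : ℕ) ε I t))
    (φ : ℝ → ℝ) (hφ : ContDiffOn ℝ (⊤ : ℕ∞) φ J) (hφJI : Set.MapsTo φ J I)
    (hφ' : ∀ τ ∈ J, derivWithin φ J τ ≠ 0)
    (g : ℝ → ℝ) (hg : ContDiffOn ℝ (⊤ : ℕ∞) g J) (hg0 : ∀ τ ∈ J, g τ ≠ 0)
    (hprojt : ∀ τ ∈ J, iteratedDerivWithin k (fun σ => g σ • ε (φ σ)) J τ ∈
      Submodule.span ℝ (Set.range fun i : Fin (k - 2) =>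
        iteratedDerivWithin (i : ℕ) (fun σ => g σ • ε (φ σ)) J τ)) :
    ∀ τ ∈ J,
      derivWithin (fun σ => derivWithin (derivWithin φ J) J σ / (2 * derivWithin φ J σ)) J τ
        - (derivWithin (derivWithin φ J) J τ / (2 * derivWithin φ J τ))^2 = 0 := by
  obtain ⟨m, rfl⟩ : ∃ m, k = m + 2 := ⟨k - 2, by omega⟩
  change ∀ t ∈ I, iteratedDerivWithin (m + 2) ε I t ∈
    Submodule.span ℝ (Set.range fun i : Fin m => iteratedDerivWithin (i : ℕ) ε I t) at hproj
  change ∀ τ ∈ J, iteratedDerivWithin (m + 2) (fun σ => g σ • ε (φ σ)) J τ ∈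
    Submodule.span ℝ (Set.range fun i : Fin m =>
      iteratedDerivWithin (i : ℕ) (fun σ => g σ • ε (φ σ)) J τ) at hprojt
  set f := derivWithin φ J with hfdef
  have hf : ContDiffOn ℝ (⊤ : ℕ∞) f J :=
    hφ.derivWithin hJopen.uniqueDiffOn (by exact_mod_cast le_refl _)
  have hφd : ∀ τ ∈ J, HasDerivAt φ (f τ) τ := fun τ hτ => by
    rw [hfdef, derivWithin_of_isOpen hJopen hτ]
    exact hφ.hasDerivAt_of_isOpen_top hJopen hτ
  have hexp := iteratedDerivWithin_smul_comp hIopen hJopen hε hφd hφJI hf hg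
  have hzero : ∀ τ ∈ J, reparamCoeff f g (m + 2) m τ = 0 ∧
      reparamCoeff f g (m + 2) (m + 1) τ = 0 := by
    intro τ hτ
    refine (hreg (φ τ) (hφJI hτ)).1.eq_zero_of_add_mem_span
      (v := fun j => iteratedDerivWithin j ε I (φ τ)) ?_
    set W := Submodule.span ℝ (Set.range fun i : Fin m => iteratedDerivWithin (i : ℕ) ε I (φ τ))
    have hlow : ∀ j < m, iteratedDerivWithin j ε I (φ τ) ∈ W := fun j hj =>
      Submodule.subset_span ⟨⟨j, hj⟩, rfl⟩
    have hle : Submodule.span ℝ (Set.range fun i : Fin m =>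
        iteratedDerivWithin (i : ℕ) (fun σ => g σ • ε (φ σ)) J τ) ≤ W := by
      rw [Submodule.span_le]
      rintro _ ⟨i, rfl⟩
      simp only [hexp i τ hτ]
      exact W.sum_mem fun j hj => W.smul_mem _ (hlow j (by have := Finset.mem_range.1 hj; omega))
    have hmem := hle (hprojt τ hτ)
    rw [hexp (m + 2) τ hτ, Finset.sum_range_succ, Finset.sum_range_succ, Finset.sum_range_succ,
      add_assoc (Finset.sum _ _)] at hmem
    rw [W.add_mem_iff_left (W.smul_mem _ (hproj (φ τ) (hφJI hτ)))] at hmem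
    rwa [W.add_mem_iff_right
      (W.sum_mem fun j hj => W.smul_mem _ (hlow j (Finset.mem_range.1 hj)))] at hmem
  set h : ℝ → ℝ := fun σ => deriv g σ / g σ with hh
  set u : ℝ → ℝ := fun σ => deriv f σ / f σ with hu
  have hus : ContDiffOn ℝ (⊤ : ℕ∞) u J := (hf.deriv_of_isOpen_top hJopen).div hf hφ'
  have hhu : Set.EqOn h (fun σ => -((m : ℝ) + 1) / 2 * u σ) J := by
    intro σ hσ
    have h1 := (hzero σ hσ).2
    rw [reparamCoeff_succ_self hJopen hf hg hφ' hg0 (m + 1) hσ] at h1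
    have h2 := (mul_eq_zero.1 h1).resolve_left
      (mul_ne_zero (hg0 σ hσ) (pow_ne_zero _ (hφ' σ hσ)))
    push_cast at h2
    have h3 : ((m : ℝ) + 1 + 1) * (h σ + ((m : ℝ) + 1) / 2 * u σ) = 0 := by
      simp only [hh, hu]; linear_combination h2
    have h4 := (mul_eq_zero.1 h3).resolve_left (by positivity)
    simp only
    linear_combination h4
  intro τ hτ
  have hdu := hus.hasDerivAt_of_isOpen_top hJopen hτ
  have hdh : deriv h τ = -((m : ℝ) + 1) / 2 * deriv u τ := by
    rw [deriv_eq_of_eqOn_isOpen hJopen hhu hτ]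
    exact (hdu.const_mul _).deriv
  have hhalf : Set.EqOn (fun σ => derivWithin f J σ / (2 * f σ)) (fun σ => 1 / 2 * u σ) J := by
    intro σ hσ
    have := hφ' σ hσ
    simp only [hu, derivWithin_of_isOpen hJopen hσ]
    field_simp
  have hhalfτ := hhalf hτ
  beta_reduce at hhalfτ
  rw [derivWithin_of_isOpen hJopen hτ, deriv_eq_of_eqOn_isOpen hJopen hhalf hτ, hhalfτ,
    (hdu.const_mul _).deriv]
  have h1 := (hzero τ hτ).1
  rw [reparamCoeff_add_two_self hJopen hf hg hφ' hg0 m hh hu hτ] at h1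
  have h2 := (mul_eq_zero.1 h1).resolve_left
    (mul_ne_zero (hg0 τ hτ) (pow_ne_zero _ (hφ' τ hτ)))
  rw [hdh, hhu hτ] at h2
  have h3 : ((m : ℝ) + 1) * (m + 2) * (m + 3) * (1 / 2 * deriv u τ - (1 / 2 * u τ) ^ 2) = 0 := by
    linear_combination -6 * h2
  exact (mul_eq_zero.1 h3).resolve_left (by positivity)
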